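/- arXiv:1808.00307 — 7 statements merged into one kernel-verified Lean document; each statement's English description precedes it below -/
import Mathlib

section
/- Fix a pool of M models: for each i ∈ {1,…,M}, let H_i be an n×n real matrix, L_i an m_i×n real matrix, b_i ∈ ℝ^{m_i} with b_i ≥ 0 componentwise, and M_i a p_i×n real matrix. Let f : ℕ → ℝ^n be any sequence, σ : ℕ → {1,…,M} a switching signal, and suppose that for each time k, φ(k) ∈ ℝ^n is a global minimizer of U ↦ Uᵀ H_{σ(k)} U − Uᵀ f(k) over {U : L_{σ(k)} U ≤ b_{σ(k)}, M_{σ(k)} U = 0}. Then for every finite horizon T ∈ ℕ: ∑_{k=0}^{T} [f(k); φ(k)]ᵀ [[0, I],[I, −2H_{σ(k)}]] [f(k); φ(k)] ≥ 0, i.e., ∑_{k=0}^{T} 2(φ(k)ᵀ f(k) − φ(k)ᵀ H_{σ(k)} φ(k)) ≥ 0. -/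
open Matrix

/-- Lemma 1 (single-parametrization multipliers): the multi-model QP controller
satisfies the time-domain hard IQC
`∑_{k=0}^{T} [f(k); φ(k)]ᵀ [[0, I],[I, −2H_{σ(k)}]] [f(k); φ(k)]
  = ∑_{k=0}^{T} 2(φ(k)ᵀ f(k) − φ(k)ᵀ H_{σ(k)} φ(k)) ≥ 0`
for every finite horizon `T`. -/
theorem multi_model_qp_hard_IQC {M n : ℕ} (m p : Fin M → ℕ)
    (H : Fin M → Matrix (Fin n) (Fin n) ℝ)
    (L : (i : Fin M) → Matrix (Fin (m i)) (Fin n) ℝ)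
    (b : (i : Fin M) → Fin (m i) → ℝ) (hb : ∀ i j, 0 ≤ b i j)
    (Mc : (i : Fin M) → Matrix (Fin (p i)) (Fin n) ℝ)
    (f : ℕ → Fin n → ℝ) (σ : ℕ → Fin M) (φ : ℕ → Fin n → ℝ)
    (hfeas : ∀ k, (∀ j, (L (σ k) *ᵥ φ k) j ≤ b (σ k) j) ∧ Mc (σ k) *ᵥ φ k = 0)
    (hmin : ∀ (k : ℕ) (U : Fin n → ℝ), (∀ j, (L (σ k) *ᵥ U) j ≤ b (σ k) j) →
      Mc (σ k) *ᵥ U = 0 →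
      φ k ⬝ᵥ (H (σ k) *ᵥ φ k) - φ k ⬝ᵥ f k ≤ U ⬝ᵥ (H (σ k) *ᵥ U) - U ⬝ᵥ f k) :
    ∀ T : ℕ, 0 ≤ ∑ k ∈ Finset.range (T + 1),
      2 * (φ k ⬝ᵥ f k - φ k ⬝ᵥ (H (σ k) *ᵥ φ k)) := by
  intro T
  refine Finset.sum_nonneg fun k _ => ?_
  have h := hmin k 0 (fun j => by simpa using hb (σ k) j) (by simp)
  simp only [zero_dotProduct, sub_zero] at h
  linarith
end

section
/- Let H be a symmetric n×n real matrix, f ∈ ℝ^n, and lo, hi ∈ ℝ^n with lo ≤ 0 ≤ hi componentwise. If φ is a global minimizer of U ↦ (1/2)Uᵀ H U − Uᵀ f over the box {U ∈ ℝ^n : lo ≤ U ≤ hi componentwise}, then for every coordinate j one has φ_j · ((Hφ)_j − f_j) ≤ 0; consequently, for every diagonal matrix K with nonnegative diagonal entries, φᵀ K (Hφ − f) ≤ 0. -/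
open Matrix

/-- Second-order expansion of a symmetric quadratic objective. -/
theorem quadratic_objective_add {ι : Type*} [Fintype ι] {H : Matrix ι ι ℝ} (hH : H.IsSymm)
    (f x v : ι → ℝ) :
    (1 / 2) * ((x + v) ⬝ᵥ (H *ᵥ (x + v))) - (x + v) ⬝ᵥ f =
      ((1 / 2) * (x ⬝ᵥ (H *ᵥ x)) - x ⬝ᵥ f) + v ⬝ᵥ (H *ᵥ x - f) + (1 / 2) * (v ⬝ᵥ (H *ᵥ v)) := by
  have hsymm : x ⬝ᵥ (H *ᵥ v) = v ⬝ᵥ (H *ᵥ x) := by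
    rw [dotProduct_mulVec, ← mulVec_transpose, hH.eq, dotProduct_comm]
  simp only [mulVec_add, add_dotProduct, dotProduct_add, dotProduct_sub, hsymm]
  ring

theorem nonpos_of_forall_le_mul {a b : ℝ} (h : ∀ t : ℝ, 0 < t → t ≤ 1 → a ≤ t * b) : a ≤ 0 := by
  by_contra! ha
  have hs : 0 < a + |b| := by positivity
  have hle := h (a / (a + |b|)) (by positivity) ((div_le_one hs).2 (by linarith [abs_nonneg b]))
  rw [div_mul_eq_mul_div, le_div_iff₀ hs] at hle
  nlinarith [le_abs_self b, mul_pos ha ha]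

theorem Matrix.IsDiag.mulVec_apply {ι R : Type*} [Fintype ι] [NonUnitalNonAssocSemiring R]
    {K : Matrix ι ι R} (hK : K.IsDiag) (w : ι → R) (j : ι) : (K *ᵥ w) j = K j j * w j :=
  Finset.sum_eq_single j (fun i _ hij => by simp [hK hij.symm]) (by simp)

/-- Static sector condition for a box-constrained QP whose box contains the origin:
each coordinate satisfies `φ_j · ((Hφ)_j − f_j) ≤ 0`, and consequently
`φᵀ K (Hφ − f) ≤ 0` for every diagonal matrix `K` with nonnegative diagonal. -/
theorem box_qp_coordinatewise_sector {n : ℕ}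
    (H : Matrix (Fin n) (Fin n) ℝ) (hH : H.IsSymm)
    (f lo hi : Fin n → ℝ) (hlo : ∀ j, lo j ≤ 0) (hhi : ∀ j, 0 ≤ hi j)
    (φ : Fin n → ℝ)
    (hfeas : ∀ j, lo j ≤ φ j ∧ φ j ≤ hi j)
    (hmin : ∀ U : Fin n → ℝ, (∀ j, lo j ≤ U j ∧ U j ≤ hi j) →
      (1 / 2) * (φ ⬝ᵥ (H *ᵥ φ)) - φ ⬝ᵥ f ≤ (1 / 2) * (U ⬝ᵥ (H *ᵥ U)) - U ⬝ᵥ f) :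
    (∀ j, φ j * ((H *ᵥ φ) j - f j) ≤ 0) ∧
    (∀ K : Matrix (Fin n) (Fin n) ℝ, K.IsDiag → (∀ j, 0 ≤ K j j) →
      φ ⬝ᵥ (K *ᵥ (H *ᵥ φ - f)) ≤ 0) := by
  have hcoord : ∀ j, φ j * ((H *ᵥ φ) j - f j) ≤ 0 := by
    intro j
    refine nonpos_of_forall_le_mul (b := (1 / 2) * (φ j * (H j j * φ j))) fun t ht ht1 => ?_
    have hU := hmin (φ + Pi.single j (-(t * φ j))) fun i => by
      rcases eq_or_ne i j with rfl | hij
      · simp only [Pi.add_apply, Pi.single_eq_same]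
        constructor <;> nlinarith [hlo i, hhi i, hfeas i]
      · simpa [hij] using hfeas i
    rw [quadratic_objective_add hH] at hU
    simp only [single_dotProduct, mulVec_single, Pi.sub_apply, Pi.smul_apply, col_apply,
      MulOpposite.smul_eq_mul_unop, MulOpposite.unop_op] at hU
    refine le_of_mul_le_mul_left ?_ ht
    linarith
  refine ⟨hcoord, fun K hK hnonneg => Finset.sum_nonpos fun j _ => ?_⟩
  rw [hK.mulVec_apply, mul_left_comm]
  exact mul_nonpos_of_nonneg_of_nonpos (hnonneg j) (hcoord j)
end

section
/- Fix a pool of M models: for each i ∈ {1,…,M}, let H_i be a symmetric n×n real matrix, and fix box bounds lo, hi ∈ ℝ^n with lo ≤ 0 ≤ hi componentwise. Let f : ℕ → ℝ^n be any sequence, σ : ℕ → {1,…,M} a switching signal, and suppose that for each time k, φ(k) is a global minimizer of U ↦ (1/2)Uᵀ H_{σ(k)} U − Uᵀ f(k) over the box {U : lo ≤ U ≤ hi}. Then for every family K_1,…,K_M of diagonal n×n matrices with nonnegative diagonal entries and every finite horizon T ∈ ℕ: ∑_{k=0}^{T} [f(k); φ(k)]ᵀ M^φ_{σ(k)} [f(k);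 φ(k)] ≥ 0, where M^φ_i := [[0, K_i],[K_i, −K_i H_i − H_i K_i]]. -/
open Matrix

/-- If `c * t + d * t ^ 2` is nonnegative for all small positive `t`, then `c` is nonnegative. -/
theorem nonneg_of_forall_mul_add_mul_sq_nonneg {c d : ℝ}
    (h : ∀ t : ℝ, 0 < t → t ≤ 1 → 0 ≤ c * t + d * t ^ 2) : 0 ≤ c := by
  by_contra! hc
  have hden : 0 < |d| - c := by linarith [abs_nonneg d]
  have ht : 0 < -c / (2 * (|d| - c)) := div_pos (by linarith) (by linarith)
  have ht1 : -c / (2 * (|d| - c)) ≤ 1 := by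
    rw [div_le_one (by linarith)]
    linarith [abs_nonneg d]
  have hmul : -c / (2 * (|d| - c)) * (|d| - c) = -c / 2 := by
    field_simp
  have hq := h _ ht ht1
  generalize -c / (2 * (|d| - c)) = t at *
  have hq' : 0 ≤ c + d * t := by
    refine nonneg_of_mul_nonneg_right (a := t) ?_ ht
    linarith
  nlinarith [le_abs_self d]

/-- Expansion of a symmetric quadratic form along a coordinate direction. -/
theorem Matrix.IsSymm.quadratic_add_single {n : Type*} [Fintype n] [DecidableEq n]
    {H : Matrix n n ℝ} (hH : H.IsSymm) (x : n → ℝ) (j : n) (s : ℝ) :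
    (x + Pi.single j s) ⬝ᵥ (H *ᵥ (x + Pi.single j s)) =
      x ⬝ᵥ (H *ᵥ x) + 2 * s * (H *ᵥ x) j + s ^ 2 * H j j := by
  have hsymm : x ⬝ᵥ (H *ᵥ Pi.single j s) = s * (H *ᵥ x) j := by
    rw [dotProduct_mulVec, ← mulVec_transpose, hH.eq, dotProduct_single, mul_comm]
  rw [mulVec_add, add_dotProduct, dotProduct_add, dotProduct_add, hsymm,
    single_dotProduct, single_dotProduct, mulVec_single]
  simp
  ring

/-- Sector condition: at a minimizer of a quadratic over a box containing the origin, each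
coordinate has nonnegative product with the corresponding entry of the negative gradient. -/
theorem mul_sub_mulVec_nonneg_of_box_minimizer {n : Type*} [Fintype n] [DecidableEq n]
    {H : Matrix n n ℝ} (hH : H.IsSymm) {lo hi f x : n → ℝ}
    (hlo : ∀ j, lo j ≤ 0) (hhi : ∀ j, 0 ≤ hi j)
    (hx : ∀ j, lo j ≤ x j ∧ x j ≤ hi j)
    (hmin : ∀ U : n → ℝ, (∀ j, lo j ≤ U j ∧ U j ≤ hi j) →
      (1 / 2) * (x ⬝ᵥ (H *ᵥ x)) - x ⬝ᵥ f ≤ (1 / 2) * (U ⬝ᵥ (H *ᵥ U)) - U ⬝ᵥ f) (j : n) :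
    0 ≤ x j * (f j - (H *ᵥ x) j) := by
  refine nonneg_of_forall_mul_add_mul_sq_nonneg (d := x j ^ 2 * H j j / 2) fun t ht ht1 => ?_
  have hfeas : ∀ i, lo i ≤ (x + Pi.single j (-(t * x j)) : n → ℝ) i ∧
      (x + Pi.single j (-(t * x j)) : n → ℝ) i ≤ hi i := by
    intro i
    by_cases hij : i = j
    · subst hij
      simp only [Pi.add_apply, Pi.single_eq_same]
      constructor <;> nlinarith [hlo i, hhi i, (hx i).1, (hx i).2]
    · simpa [hij] using hx i
  have hle := hmin _ hfeas
  rw [hH.quadratic_add_single, add_dotProduct, single_dotProduct] at hle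
  linarith

/-- The box-constraint multiplier form is a weighted sum of the coordinatewise sector terms. -/
theorem box_multiplier_form_eq {n : Type*} [Fintype n] [DecidableEq n]
    {H K : Matrix n n ℝ} (hH : H.IsSymm) (hK : K.IsDiag) (f x : n → ℝ) :
    Sum.elim f x ⬝ᵥ (Matrix.fromBlocks 0 K K (-(K * H) - H * K) *ᵥ Sum.elim f x) =
      2 * ∑ j, K j j * (x j * (f j - (H *ᵥ x) j)) := by
  have hdiag (y : n → ℝ) : K *ᵥ y = fun j => K j j * y j := by
    ext j
    conv_lhs => rw [← hK.diagonal_diag]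
    simp [mulVec_diagonal]
  have hsymm : x ⬝ᵥ (H *ᵥ (K *ᵥ x)) = (H *ᵥ x) ⬝ᵥ (K *ᵥ x) := by
    rw [dotProduct_mulVec, ← mulVec_transpose, hH.eq]
  rw [fromBlocks_mulVec, sumElim_dotProduct_sumElim]
  simp only [Sum.elim_comp_inl, Sum.elim_comp_inr, zero_mulVec, zero_add, sub_mulVec,
    neg_mulVec, ← mulVec_mulVec, dotProduct_add, dotProduct_sub, dotProduct_neg, hsymm]
  simp only [hdiag, dotProduct, ← Finset.sum_neg_distrib, ← Finset.sum_sub_distrib,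
    ← Finset.sum_add_distrib, Finset.mul_sum]
  exact Finset.sum_congr rfl fun j _ => by ring

/-- Lemma 5 (box-constraint multipliers): the multi-model box-constrained QP
controller satisfies, for every family of nonnegative diagonal matrices `K_i`
and every finite horizon `T`, the hard IQC
`∑_{k=0}^{T} [f(k); φ(k)]ᵀ M^φ_{σ(k)} [f(k); φ(k)] ≥ 0`
with `M^φ_i = [[0, K_i],[K_i, −K_i H_i − H_i K_i]]`. -/
theorem multi_model_box_qp_hard_IQC {M n : ℕ}
    (H : Fin M → Matrix (Fin n) (Fin n) ℝ) (hH : ∀ i, (H i).IsSymm)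
    (lo hi : Fin n → ℝ) (hlo : ∀ j, lo j ≤ 0) (hhi : ∀ j, 0 ≤ hi j)
    (f φ : ℕ → Fin n → ℝ) (σ : ℕ → Fin M)
    (hfeas : ∀ k j, lo j ≤ φ k j ∧ φ k j ≤ hi j)
    (hmin : ∀ (k : ℕ) (U : Fin n → ℝ), (∀ j, lo j ≤ U j ∧ U j ≤ hi j) →
      (1 / 2) * (φ k ⬝ᵥ (H (σ k) *ᵥ φ k)) - φ k ⬝ᵥ f k ≤
        (1 / 2) * (U ⬝ᵥ (H (σ k) *ᵥ U)) - U ⬝ᵥ f k) :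
    ∀ (K : Fin M → Matrix (Fin n) (Fin n) ℝ), (∀ i, (K i).IsDiag) →
      (∀ i j, 0 ≤ K i j j) →
      ∀ T : ℕ, 0 ≤ ∑ k ∈ Finset.range (T + 1),
        Sum.elim (f k) (φ k) ⬝ᵥ
          (Matrix.fromBlocks 0 (K (σ k)) (K (σ k))
              (-(K (σ k) * H (σ k)) - H (σ k) * K (σ k)) *ᵥ
            Sum.elim (f k) (φ k)) := by
  intro K hK hKnn T
  refine Finset.sum_nonneg fun k _ => ?_
  rw [box_multiplier_form_eq (hH _) (hK _)]
  exact mul_nonneg zero_le_two <| Finset.sum_nonneg fun j _ => mul_nonneg (hKnn _ j) <|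
    mul_sub_mulVec_nonneg_of_box_minimizer (hH _) hlo hhi (hfeas k) (hmin k) j
end

section
/- Consider a switched extended system over models i ∈ {1,…,M} with matrices A_i ∈ ℝ^{n_x×n_x}, B1_i ∈ ℝ^{n_x×n_w}, B2_i ∈ ℝ^{n_x×n_d}, output channels z_j for j ∈ {1,…,N} given by matrices C1_{i,j} ∈ ℝ^{m_j×n_x}, D11_{i,j} ∈ ℝ^{m_j×n_w}, D12_{i,j} ∈ ℝ^{m_j×n_d}, and error output matrices C2_i ∈ ℝ^{n_e×n_x}, D21_i ∈ ℝ^{n_e×n_w}, D22_i ∈ ℝ^{n_e×n_d}. Let σ : ℕ → {1,…,M} be a switching signal and let sequences x, w, d, e and z_1,…,z_N satisfy x(0) = 0, x(k+1) = A_{σ(k)}x(k) + B1_{σ(k)}w(k) + B2_{σ(k)}d(k), z_j(k) = C1_{σ(k),j}x(k) + D11_{σ(k),j}w(k) + D12_{σ(k),j}d(k), and e(k) = C2_{σ(k)}x(k) + D21_{σ(k)}w(k) + D22_{σ(k)}d(k). Let M_1^1,…,M_1^M be symmetric m_1×m_1 matrices (controller multipliers) and M_2,…,M_N symmetric m_j×m_j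 matrices (uncertainty multipliers), and assume the hard IQCs: for every T, ∑_{k=0}^{T} z_1(k)ᵀ M_1^{σ(k)} z_1(k) ≥ 0 and, for each j ∈ {2,…,N}, ∑_{k=0}^{T} z_j(k)ᵀ M_j z_j(k) ≥ 0. Suppose there exist a symmetric positive semidefinite matrix P ∈ ℝ^{n_x×n_x}, γ ≥ 0, and nonnegative scalars λ_1,…,λ_N such that for every model i and every nonzero (ξ, ω, δ) ∈ ℝ^{n_x}×ℝ^{n_w}×ℝ^{n_d}: (A_iξ + B1_iω + B2_iδ)ᵀP(A_iξ + B1_iω + B2_iδ) − ξᵀPξ + ‖C2_iξ + D21_iω + D22_iδ‖² + λ_1 ζ_1ᵀ M_1^i ζ_1 + ∑_{j=2}^{N} λ_j ζ_jᵀ M_j ζ_j − γ²‖δ‖² < 0, where ζ_j := C1_{i,j}ξ + D11_{i,j}ω + D12_{i,j}δ. Then for every T ∈ ℕ: ∑_{k=0}^{T} ‖e(k)‖² ≤ γ² ∑_{k=0}^{T} ‖d(k)‖². -/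
open Matrix

/-- Theorem 1 (single-parametrization multipliers): dissipation-based finite-horizon
`l₂`-gain bound for a switched extended system with a common quadratic storage
function `V(x) = xᵀPx`, a controller channel `zc` satisfying hard IQCs with
model-dependent multipliers `M1_i`, and uncertainty channels `zu_j` satisfying
hard IQCs with multipliers `Mu_j`.  If the LMI-quadratic-form inequality holds
strictly at every nonzero `(ξ, ω, δ)` for every model `i`, then
`∑_{k=0}^{T} ‖e(k)‖² ≤ γ² ∑_{k=0}^{T} ‖d(k)‖²` for every horizon `T`. -/
theorem switched_dissipation_single_parametrization
    {M N nx nw nd ne mc : ℕ} (mu : Fin N → ℕ)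
    (A : Fin M → Matrix (Fin nx) (Fin nx) ℝ)
    (B1 : Fin M → Matrix (Fin nx) (Fin nw) ℝ)
    (B2 : Fin M → Matrix (Fin nx) (Fin nd) ℝ)
    (Cc : Fin M → Matrix (Fin mc) (Fin nx) ℝ)
    (Dc1 : Fin M → Matrix (Fin mc) (Fin nw) ℝ)
    (Dc2 : Fin M → Matrix (Fin mc) (Fin nd) ℝ)
    (Cu : Fin M → (j : Fin N) → Matrix (Fin (mu j)) (Fin nx) ℝ)
    (Du1 : Fin M → (j : Fin N) → Matrix (Fin (mu j)) (Fin nw) ℝ)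
    (Du2 : Fin M → (j : Fin N) → Matrix (Fin (mu j)) (Fin nd) ℝ)
    (C2 : Fin M → Matrix (Fin ne) (Fin nx) ℝ)
    (D21 : Fin M → Matrix (Fin ne) (Fin nw) ℝ)
    (D22 : Fin M → Matrix (Fin ne) (Fin nd) ℝ)
    (σ : ℕ → Fin M)
    (x : ℕ → Fin nx → ℝ) (w : ℕ → Fin nw → ℝ) (d : ℕ → Fin nd → ℝ)
    (e : ℕ → Fin ne → ℝ) (zc : ℕ → Fin mc → ℝ)
    (zu : (j : Fin N) → ℕ → Fin (mu j) → ℝ)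
    (hx0 : x 0 = 0)
    (hdyn : ∀ k, x (k + 1) = A (σ k) *ᵥ x k + B1 (σ k) *ᵥ w k + B2 (σ k) *ᵥ d k)
    (hzc : ∀ k, zc k = Cc (σ k) *ᵥ x k + Dc1 (σ k) *ᵥ w k + Dc2 (σ k) *ᵥ d k)
    (hzu : ∀ j k, zu j k = Cu (σ k) j *ᵥ x k + Du1 (σ k) j *ᵥ w k + Du2 (σ k) j *ᵥ d k)
    (he : ∀ k, e k = C2 (σ k) *ᵥ x k + D21 (σ k) *ᵥ w k + D22 (σ k) *ᵥ d k)
    (M1 : Fin M → Matrix (Fin mc) (Fin mc) ℝ) (hM1 : ∀ i, (M1 i).IsSymm)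
    (Mu : (j : Fin N) → Matrix (Fin (mu j)) (Fin (mu j)) ℝ) (hMu : ∀ j, (Mu j).IsSymm)
    (hIQCc : ∀ T : ℕ, 0 ≤ ∑ k ∈ Finset.range (T + 1), zc k ⬝ᵥ (M1 (σ k) *ᵥ zc k))
    (hIQCu : ∀ j, ∀ T : ℕ, 0 ≤ ∑ k ∈ Finset.range (T + 1), zu j k ⬝ᵥ (Mu j *ᵥ zu j k))
    (P : Matrix (Fin nx) (Fin nx) ℝ) (hP : P.PosSemidef)
    (γ : ℝ) (hγ : 0 ≤ γ)
    (lc : ℝ) (hlc : 0 ≤ lc) (lu : Fin N → ℝ) (hlu : ∀ j, 0 ≤ lu j)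
    (hLMI : ∀ (i : Fin M) (ξ : Fin nx → ℝ) (ω : Fin nw → ℝ) (δ : Fin nd → ℝ),
      ¬(ξ = 0 ∧ ω = 0 ∧ δ = 0) →
      (A i *ᵥ ξ + B1 i *ᵥ ω + B2 i *ᵥ δ) ⬝ᵥ
          (P *ᵥ (A i *ᵥ ξ + B1 i *ᵥ ω + B2 i *ᵥ δ))
        - ξ ⬝ᵥ (P *ᵥ ξ)
        + (C2 i *ᵥ ξ + D21 i *ᵥ ω + D22 i *ᵥ δ) ⬝ᵥ
            (C2 i *ᵥ ξ + D21 i *ᵥ ω + D22 i *ᵥ δ)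
        + lc * ((Cc i *ᵥ ξ + Dc1 i *ᵥ ω + Dc2 i *ᵥ δ) ⬝ᵥ
            (M1 i *ᵥ (Cc i *ᵥ ξ + Dc1 i *ᵥ ω + Dc2 i *ᵥ δ)))
        + ∑ j, lu j * ((Cu i j *ᵥ ξ + Du1 i j *ᵥ ω + Du2 i j *ᵥ δ) ⬝ᵥ
            (Mu j *ᵥ (Cu i j *ᵥ ξ + Du1 i j *ᵥ ω + Du2 i j *ᵥ δ)))
        - γ ^ 2 * (δ ⬝ᵥ δ) < 0) :
    ∀ T : ℕ, ∑ k ∈ Finset.range (T + 1), e k ⬝ᵥ e k ≤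
      γ ^ 2 * ∑ k ∈ Finset.range (T + 1), d k ⬝ᵥ d k := by
  have hstep (k : ℕ) : x (k + 1) ⬝ᵥ (P *ᵥ x (k + 1)) - x k ⬝ᵥ (P *ᵥ x k) + e k ⬝ᵥ e k
      + lc * (zc k ⬝ᵥ (M1 (σ k) *ᵥ zc k)) + ∑ j, lu j * (zu j k ⬝ᵥ (Mu j *ᵥ zu j k))
      - γ ^ 2 * (d k ⬝ᵥ d k) ≤ 0 := by
    simp only [hdyn k, he k, hzc k, hzu _ k]
    by_cases h : x k = 0 ∧ w k = 0 ∧ d k = 0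
    · simp [h.1, h.2.1, h.2.2]
    · exact (hLMI (σ k) (x k) (w k) (d k) h).le
  intro T
  have hsum := Finset.sum_nonpos fun k (_ : k ∈ Finset.range (T + 1)) => hstep k
  simp only [Finset.sum_sub_distrib, Finset.sum_add_distrib, ← Finset.mul_sum] at hsum
  rw [← Finset.sum_sub_distrib, Finset.sum_range_sub (fun k => x k ⬝ᵥ (P *ᵥ x k)),
    Finset.sum_comm] at hsum
  simp only [← Finset.mul_sum, hx0, zero_dotProduct, sub_zero] at hsum
  have hV : 0 ≤ x (T + 1) ⬝ᵥ (P *ᵥ x (T + 1)) := by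
    simpa using hP.dotProduct_mulVec_nonneg (x (T + 1))
  have hc := mul_nonneg hlc (hIQCc T)
  have hu := Finset.sum_nonneg fun j (_ : j ∈ Finset.univ) => mul_nonneg (hlu j) (hIQCu j T)
  linarith
end

section
/- Consider a switched extended system over models i ∈ {1,…,M} with matrices A_i ∈ ℝ^{n_x×n_x}, B1_i ∈ ℝ^{n_x×n_w}, B2_i ∈ ℝ^{n_x×n_d}, output channels z_j for j ∈ {1,…,N} given by matrices C1_{i,j} ∈ ℝ^{m_j×n_x}, D11_{i,j} ∈ ℝ^{m_j×n_w}, D12_{i,j} ∈ ℝ^{m_j×n_d}, and error output matrices C2_i, D21_i, D22_i. Let σ : ℕ → {1,…,M} be a switching signal and let sequences x, w, d, e and z_1,…,z_N satisfy x(0) = 0 and the switched dynamics and output equations as above. Let M_1^1,…,M_1^M be symmetric m_1×m_1 matrices, λ_1^1,…,λ_1^M ≥ 0 model-dependent nonnegative scalars, and M_2,…,M_N symmetric multiplier matrices with λ_2,…,λ_N ≥ 0. Assume the hard IQCs: for every T, ∑_{k=0}^{T} λ_1^{σ(k)} z_1(k)ᵀ M_1^{σ(k)} z_1(k) ≥ 0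 and, for each j ∈ {2,…,N}, ∑_{k=0}^{T} z_j(k)ᵀ M_j z_j(k) ≥ 0. Suppose there exist a symmetric positive semidefinite P ∈ ℝ^{n_x×n_x} and γ ≥ 0 such that for every model i and every nonzero (ξ, ω, δ): (A_iξ + B1_iω + B2_iδ)ᵀP(A_iξ + B1_iω + B2_iδ) − ξᵀPξ + ‖C2_iξ + D21_iω + D22_iδ‖² + λ_1^i ζ_1ᵀ M_1^i ζ_1 + ∑_{j=2}^{N} λ_j ζ_jᵀ M_j ζ_j − γ²‖δ‖² < 0, where ζ_j := C1_{i,j}ξ + D11_{i,j}ω + D12_{i,j}δ. Then for every T ∈ ℕ: ∑_{k=0}^{T} ‖e(k)‖² ≤ γ² ∑_{k=0}^{T} ‖d(k)‖². -/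
open Matrix

/-- Summed dissipation inequality: if the storage `V` starts at zero, stays nonnegative and
satisfies `V (k + 1) - V k + y k + s k ≤ u k`, then nonnegativity of the accumulated multiplier
terms `s` bounds the accumulated output `y` by the accumulated supply `u`. -/
theorem sum_le_sum_of_dissipation {V y s u : ℕ → ℝ} (hV0 : V 0 = 0) (hV : ∀ k, 0 ≤ V k)
    (hstep : ∀ k, V (k + 1) - V k + y k + s k ≤ u k) {n : ℕ}
    (hs : 0 ≤ ∑ k ∈ Finset.range n, s k) :
    ∑ k ∈ Finset.range n, y k ≤ ∑ k ∈ Finset.range n, u k := by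
  have h := Finset.sum_le_sum fun k (_ : k ∈ Finset.range n) => hstep k
  simp only [Finset.sum_add_distrib, Finset.sum_range_sub] at h
  linarith [hV n]

/-- Theorem 2 (conic-combination multipliers): dissipation-based finite-horizon
`l₂`-gain bound for a switched extended system with a common quadratic storage
function `V(x) = xᵀPx`.  The controller channel `zc` satisfies a hard IQC with
model-dependent multipliers `M1_i` weighted by model-dependent nonnegative
scalars `λ1_i`; the uncertainty channels `zu_j` satisfy hard IQCs with
multipliers `Mu_j`.  If the LMI-quadratic-form inequality holds strictly at
every nonzero `(ξ, ω, δ)` for every model `i`, then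
`∑_{k=0}^{T} ‖e(k)‖² ≤ γ² ∑_{k=0}^{T} ‖d(k)‖²` for every horizon `T`. -/
theorem switched_dissipation_conic_combination
    {M N nx nw nd ne mc : ℕ} (mu : Fin N → ℕ)
    (A : Fin M → Matrix (Fin nx) (Fin nx) ℝ)
    (B1 : Fin M → Matrix (Fin nx) (Fin nw) ℝ)
    (B2 : Fin M → Matrix (Fin nx) (Fin nd) ℝ)
    (Cc : Fin M → Matrix (Fin mc) (Fin nx) ℝ)
    (Dc1 : Fin M → Matrix (Fin mc) (Fin nw) ℝ)
    (Dc2 : Fin M → Matrix (Fin mc) (Fin nd) ℝ)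
    (Cu : Fin M → (j : Fin N) → Matrix (Fin (mu j)) (Fin nx) ℝ)
    (Du1 : Fin M → (j : Fin N) → Matrix (Fin (mu j)) (Fin nw) ℝ)
    (Du2 : Fin M → (j : Fin N) → Matrix (Fin (mu j)) (Fin nd) ℝ)
    (C2 : Fin M → Matrix (Fin ne) (Fin nx) ℝ)
    (D21 : Fin M → Matrix (Fin ne) (Fin nw) ℝ)
    (D22 : Fin M → Matrix (Fin ne) (Fin nd) ℝ)
    (σ : ℕ → Fin M)
    (x : ℕ → Fin nx → ℝ) (w : ℕ → Fin nw → ℝ) (d : ℕ → Fin nd → ℝ)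
    (e : ℕ → Fin ne → ℝ) (zc : ℕ → Fin mc → ℝ)
    (zu : (j : Fin N) → ℕ → Fin (mu j) → ℝ)
    (hx0 : x 0 = 0)
    (hdyn : ∀ k, x (k + 1) = A (σ k) *ᵥ x k + B1 (σ k) *ᵥ w k + B2 (σ k) *ᵥ d k)
    (hzc : ∀ k, zc k = Cc (σ k) *ᵥ x k + Dc1 (σ k) *ᵥ w k + Dc2 (σ k) *ᵥ d k)
    (hzu : ∀ j k, zu j k = Cu (σ k) j *ᵥ x k + Du1 (σ k) j *ᵥ w k + Du2 (σ k) j *ᵥ d k)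
    (he : ∀ k, e k = C2 (σ k) *ᵥ x k + D21 (σ k) *ᵥ w k + D22 (σ k) *ᵥ d k)
    (M1 : Fin M → Matrix (Fin mc) (Fin mc) ℝ) (hM1 : ∀ i, (M1 i).IsSymm)
    (Mu : (j : Fin N) → Matrix (Fin (mu j)) (Fin (mu j)) ℝ) (hMu : ∀ j, (Mu j).IsSymm)
    (lc : Fin M → ℝ) (hlc : ∀ i, 0 ≤ lc i)
    (hIQCc : ∀ T : ℕ, 0 ≤ ∑ k ∈ Finset.range (T + 1),
      lc (σ k) * (zc k ⬝ᵥ (M1 (σ k) *ᵥ zc k)))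
    (hIQCu : ∀ j, ∀ T : ℕ, 0 ≤ ∑ k ∈ Finset.range (T + 1), zu j k ⬝ᵥ (Mu j *ᵥ zu j k))
    (P : Matrix (Fin nx) (Fin nx) ℝ) (hP : P.PosSemidef)
    (γ : ℝ) (hγ : 0 ≤ γ)
    (lu : Fin N → ℝ) (hlu : ∀ j, 0 ≤ lu j)
    (hLMI : ∀ (i : Fin M) (ξ : Fin nx → ℝ) (ω : Fin nw → ℝ) (δ : Fin nd → ℝ),
      ¬(ξ = 0 ∧ ω = 0 ∧ δ = 0) →
      (A i *ᵥ ξ + B1 i *ᵥ ω + B2 i *ᵥ δ) ⬝ᵥ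
          (P *ᵥ (A i *ᵥ ξ + B1 i *ᵥ ω + B2 i *ᵥ δ))
        - ξ ⬝ᵥ (P *ᵥ ξ)
        + (C2 i *ᵥ ξ + D21 i *ᵥ ω + D22 i *ᵥ δ) ⬝ᵥ
            (C2 i *ᵥ ξ + D21 i *ᵥ ω + D22 i *ᵥ δ)
        + lc i * ((Cc i *ᵥ ξ + Dc1 i *ᵥ ω + Dc2 i *ᵥ δ) ⬝ᵥ
            (M1 i *ᵥ (Cc i *ᵥ ξ + Dc1 i *ᵥ ω + Dc2 i *ᵥ δ)))
        + ∑ j, lu j * ((Cu i j *ᵥ ξ + Du1 i j *ᵥ ω + Du2 i j *ᵥ δ) ⬝ᵥ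
            (Mu j *ᵥ (Cu i j *ᵥ ξ + Du1 i j *ᵥ ω + Du2 i j *ᵥ δ)))
        - γ ^ 2 * (δ ⬝ᵥ δ) < 0) :
    ∀ T : ℕ, ∑ k ∈ Finset.range (T + 1), e k ⬝ᵥ e k ≤
      γ ^ 2 * ∑ k ∈ Finset.range (T + 1), d k ⬝ᵥ d k := by
  intro T
  rw [Finset.mul_sum]
  refine sum_le_sum_of_dissipation (V := fun k => x k ⬝ᵥ (P *ᵥ x k))
    (s := fun k => lc (σ k) * (zc k ⬝ᵥ (M1 (σ k) *ᵥ zc k))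
      + ∑ j, lu j * (zu j k ⬝ᵥ (Mu j *ᵥ zu j k)))
    (by simp [hx0]) (fun k => by simpa using hP.dotProduct_mulVec_nonneg (x k)) (fun k => ?_) ?_
  · by_cases h : x k = 0 ∧ w k = 0 ∧ d k = 0
    · simp [hdyn, hzc, hzu, he, h.1, h.2.1, h.2.2]
    · have hk := hLMI (σ k) (x k) (w k) (d k) h
      simp only [← hdyn, ← hzc, ← hzu, ← he] at hk
      linarith
  · rw [Finset.sum_add_distrib, Finset.sum_comm]
    refine add_nonneg (hIQCc T) (Finset.sum_nonneg fun j _ => ?_)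
    rw [← Finset.mul_sum]
    exact mul_nonneg (hlu j) (hIQCu j T)
end

section
/- Consider a switched extended system over models i ∈ {1,…,M} with matrices A_i ∈ ℝ^{n_x×n_x}, B1_i ∈ ℝ^{n_x×n_w}, B2_i ∈ ℝ^{n_x×n_d}, a controller channel z_1 of dimension 2n given by matrices C1_{i,1} ∈ ℝ^{2n×n_x}, D11_{i,1}, D12_{i,1}, uncertainty channels z_j (j = 2,…,N) given by C1_{i,j}, D11_{i,j}, D12_{i,j}, and error output matrices C2_i, D21_i, D22_i. Let σ : ℕ → {1,…,M} be a switching signal and let sequences x, w, d, e and z_1,…,z_N satisfy x(0) = 0 and the switched dynamics and output equations. For each model i let H_i be a symmetric n×n matrix and K_i a diagonal n×n matrix with nonnegative diagonal entries, and set M^φ_i := [[0, K_i],[K_i, −K_i H_i − H_i K_i]]. Assume the hard IQCs: for every T, ∑_{k=0}^{T} z_1(k)ᵀ M^φ_{σ(k)} z_1(k) ≥ 0 and, for each j ∈ {2,…,N}, ∑_{k=0}^{T} z_j(k)ᵀ M_j z_j(k) ≥ 0 for symmetric multipliers M_j. Suppose there exist a symmetric positive semidefinite P ∈ ℝ^{n_x×n_x},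 γ ≥ 0 and nonnegative λ_2,…,λ_N such that for every model i and every nonzero (ξ, ω, δ): (A_iξ + B1_iω + B2_iδ)ᵀP(A_iξ + B1_iω + B2_iδ) − ξᵀPξ + ‖C2_iξ + D21_iω + D22_iδ‖² + ζ_1ᵀ M^φ_i ζ_1 + ∑_{j=2}^{N} λ_j ζ_jᵀ M_j ζ_j − γ²‖δ‖² < 0, where ζ_j := C1_{i,j}ξ + D11_{i,j}ω + D12_{i,j}δ. Then for every T ∈ ℕ: ∑_{k=0}^{T} ‖e(k)‖² ≤ γ² ∑_{k=0}^{T} ‖d(k)‖². -/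
open Matrix

/-- The box-constraint multiplier `M^φ = [[0, K],[K, −K H − H K]]`. -/
def boxMultiplier {n : ℕ} (H K : Matrix (Fin n) (Fin n) ℝ) :
    Matrix (Fin n ⊕ Fin n) (Fin n ⊕ Fin n) ℝ :=
  Matrix.fromBlocks 0 K K (-(K * H) - H * K)

/-- Summed dissipation inequality: if the storage `V` starts at zero and is bounded below by zero,
and each step satisfies the dissipation inequality with supply terms `q` (controller channel) and
`r j` (uncertainty channels) whose partial sums are nonnegative, then the accumulated output `a`
is bounded by the accumulated input `b`. -/
theorem sum_le_mul_sum_of_dissipation {ι : Type*} [Fintype ι] {V a b q : ℕ → ℝ} {r : ι → ℕ → ℝ}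
    {c : ℝ} {l : ι → ℝ} (hV0 : V 0 = 0) (hV : ∀ k, 0 ≤ V k) (hl : ∀ j, 0 ≤ l j) {m : ℕ}
    (hq : 0 ≤ ∑ k ∈ Finset.range m, q k) (hr : ∀ j, 0 ≤ ∑ k ∈ Finset.range m, r j k)
    (hstep : ∀ k, V (k + 1) - V k + a k + q k + ∑ j, l j * r j k - c * b k ≤ 0) :
    ∑ k ∈ Finset.range m, a k ≤ c * ∑ k ∈ Finset.range m, b k := by
  have hsum := Finset.sum_nonpos fun k (_ : k ∈ Finset.range m) => hstep k
  have htel := Finset.sum_range_sub V m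
  simp only [Finset.sum_add_distrib, Finset.sum_sub_distrib, ← Finset.mul_sum] at hsum htel
  rw [Finset.sum_comm] at hsum
  simp only [← Finset.mul_sum] at hsum
  have hu : 0 ≤ ∑ j, l j * ∑ k ∈ Finset.range m, r j k :=
    Finset.sum_nonneg fun j _ => mul_nonneg (hl j) (hr j)
  linarith [hV m]

/-- Theorem 3 (box-constraint multipliers): dissipation-based finite-horizon
`l₂`-gain bound for a switched extended system with a common quadratic storage
function `V(x) = xᵀPx`.  The controller channel `zc` (of dimension `2n`,
stacking the controller input and output) satisfies a hard IQC with the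
box-constraint multipliers `M^φ_i = [[0, K_i],[K_i, −K_i H_i − H_i K_i]]`,
where `K_i` is diagonal with nonnegative entries; the uncertainty channels
`zu_j` satisfy hard IQCs with multipliers `Mu_j`.  If the LMI-quadratic-form
inequality holds strictly at every nonzero `(ξ, ω, δ)` for every model `i`,
then `∑_{k=0}^{T} ‖e(k)‖² ≤ γ² ∑_{k=0}^{T} ‖d(k)‖²` for every horizon `T`. -/
theorem switched_dissipation_box_constraints
    {M N nx nw nd ne n : ℕ} (mu : Fin N → ℕ)
    (A : Fin M → Matrix (Fin nx) (Fin nx) ℝ)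
    (B1 : Fin M → Matrix (Fin nx) (Fin nw) ℝ)
    (B2 : Fin M → Matrix (Fin nx) (Fin nd) ℝ)
    (Cc : Fin M → Matrix (Fin n ⊕ Fin n) (Fin nx) ℝ)
    (Dc1 : Fin M → Matrix (Fin n ⊕ Fin n) (Fin nw) ℝ)
    (Dc2 : Fin M → Matrix (Fin n ⊕ Fin n) (Fin nd) ℝ)
    (Cu : Fin M → (j : Fin N) → Matrix (Fin (mu j)) (Fin nx) ℝ)
    (Du1 : Fin M → (j : Fin N) → Matrix (Fin (mu j)) (Fin nw) ℝ)
    (Du2 : Fin M → (j : Fin N) → Matrix (Fin (mu j)) (Fin nd) ℝ)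
    (C2 : Fin M → Matrix (Fin ne) (Fin nx) ℝ)
    (D21 : Fin M → Matrix (Fin ne) (Fin nw) ℝ)
    (D22 : Fin M → Matrix (Fin ne) (Fin nd) ℝ)
    (σ : ℕ → Fin M)
    (x : ℕ → Fin nx → ℝ) (w : ℕ → Fin nw → ℝ) (d : ℕ → Fin nd → ℝ)
    (e : ℕ → Fin ne → ℝ) (zc : ℕ → (Fin n ⊕ Fin n) → ℝ)
    (zu : (j : Fin N) → ℕ → Fin (mu j) → ℝ)
    (hx0 : x 0 = 0)
    (hdyn : ∀ k, x (k + 1) = A (σ k) *ᵥ x k + B1 (σ k) *ᵥ w k + B2 (σ k) *ᵥ d k)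
    (hzc : ∀ k, zc k = Cc (σ k) *ᵥ x k + Dc1 (σ k) *ᵥ w k + Dc2 (σ k) *ᵥ d k)
    (hzu : ∀ j k, zu j k = Cu (σ k) j *ᵥ x k + Du1 (σ k) j *ᵥ w k + Du2 (σ k) j *ᵥ d k)
    (he : ∀ k, e k = C2 (σ k) *ᵥ x k + D21 (σ k) *ᵥ w k + D22 (σ k) *ᵥ d k)
    (H : Fin M → Matrix (Fin n) (Fin n) ℝ) (hH : ∀ i, (H i).IsSymm)
    (K : Fin M → Matrix (Fin n) (Fin n) ℝ) (hKdiag : ∀ i, (K i).IsDiag)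
    (hKpos : ∀ i j, 0 ≤ K i j j)
    (Mu : (j : Fin N) → Matrix (Fin (mu j)) (Fin (mu j)) ℝ) (hMu : ∀ j, (Mu j).IsSymm)
    (hIQCc : ∀ T : ℕ, 0 ≤ ∑ k ∈ Finset.range (T + 1),
      zc k ⬝ᵥ (boxMultiplier (H (σ k)) (K (σ k)) *ᵥ zc k))
    (hIQCu : ∀ j, ∀ T : ℕ, 0 ≤ ∑ k ∈ Finset.range (T + 1), zu j k ⬝ᵥ (Mu j *ᵥ zu j k))
    (P : Matrix (Fin nx) (Fin nx) ℝ) (hP : P.PosSemidef)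
    (γ : ℝ) (hγ : 0 ≤ γ)
    (lu : Fin N → ℝ) (hlu : ∀ j, 0 ≤ lu j)
    (hLMI : ∀ (i : Fin M) (ξ : Fin nx → ℝ) (ω : Fin nw → ℝ) (δ : Fin nd → ℝ),
      ¬(ξ = 0 ∧ ω = 0 ∧ δ = 0) →
      (A i *ᵥ ξ + B1 i *ᵥ ω + B2 i *ᵥ δ) ⬝ᵥ
          (P *ᵥ (A i *ᵥ ξ + B1 i *ᵥ ω + B2 i *ᵥ δ))
        - ξ ⬝ᵥ (P *ᵥ ξ)
        + (C2 i *ᵥ ξ + D21 i *ᵥ ω + D22 i *ᵥ δ) ⬝ᵥ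
            (C2 i *ᵥ ξ + D21 i *ᵥ ω + D22 i *ᵥ δ)
        + (Cc i *ᵥ ξ + Dc1 i *ᵥ ω + Dc2 i *ᵥ δ) ⬝ᵥ
            (boxMultiplier (H i) (K i) *ᵥ (Cc i *ᵥ ξ + Dc1 i *ᵥ ω + Dc2 i *ᵥ δ))
        + ∑ j, lu j * ((Cu i j *ᵥ ξ + Du1 i j *ᵥ ω + Du2 i j *ᵥ δ) ⬝ᵥ
            (Mu j *ᵥ (Cu i j *ᵥ ξ + Du1 i j *ᵥ ω + Du2 i j *ᵥ δ)))
        - γ ^ 2 * (δ ⬝ᵥ δ) < 0) :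
    ∀ T : ℕ, ∑ k ∈ Finset.range (T + 1), e k ⬝ᵥ e k ≤
      γ ^ 2 * ∑ k ∈ Finset.range (T + 1), d k ⬝ᵥ d k := by
  intro T
  refine sum_le_mul_sum_of_dissipation (V := fun k => x k ⬝ᵥ (P *ᵥ x k)) (by simp [hx0])
    (fun k => by simpa using hP.dotProduct_mulVec_nonneg (x k)) hlu (hIQCc T)
    (fun j => hIQCu j T) fun k => ?_
  simp only [hdyn, hzc, hzu, he]
  by_cases h : x k = 0 ∧ w k = 0 ∧ d k = 0
  · simp [h]
  · exact (hLMI (σ k) (x k) (w k) (d k) h).le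
end

section
/- Consider a switched extended system over models i ∈ {1,…,M} with matrices A_i ∈ ℝ^{n_x×n_x}, B1_i ∈ ℝ^{n_x×n_w}, B2_i ∈ ℝ^{n_x×n_d}, output channels z_j for j ∈ {1,…,N} given by matrices C1_{i,j}, D11_{i,j}, D12_{i,j}, and error output matrices C2_i, D21_i, D22_i. Let σ : ℕ → {1,…,M} be a switching signal and let sequences x, w, d, e and z_1,…,z_N satisfy x(0) = 0, x(k+1) = A_{σ(k)}x(k) + B1_{σ(k)}w(k) + B2_{σ(k)}d(k), z_j(k) = C1_{σ(k),j}x(k) + D11_{σ(k),j}w(k) + D12_{σ(k),j}d(k), and e(k) = C2_{σ(k)}x(k) + D21_{σ(k)}w(k) + D22_{σ(k)}d(k). Let M^φ_1,…,M^φ_M be symmetric controller multipliers and M_2,…,M_N symmetric uncertainty multipliers with λ_2,…,λ_N ≥ 0, and assume the hard IQCs: for every T, ∑_{k=0}^{T} z_1(k)ᵀ M^φ_{σ(k)} z_1(k) ≥ 0 and, for each j ∈ {2,…,N}, ∑_{k=0}^{T} z_j(k)ᵀ M_j z_j(k) ≥ 0. Suppose there exist symmetric positive definite matrices P_1,…,P_M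 ∈ ℝ^{n_x×n_x} and γ ≥ 0 such that for every pair of models (i, j') and every (ξ, ω, δ): (A_iξ + B1_iω + B2_iδ)ᵀP_{j'}(A_iξ + B1_iω + B2_iδ) − ξᵀP_iξ + ‖C2_iξ + D21_iω + D22_iδ‖² + ζ_1ᵀ M^φ_i ζ_1 + ∑_{j=2}^{N} λ_j ζ_jᵀ M_j ζ_j − γ²‖δ‖² ≤ 0, where ζ_j := C1_{i,j}ξ + D11_{i,j}ω + D12_{i,j}δ. Then for every T ∈ ℕ: ∑_{k=0}^{T} ‖e(k)‖² ≤ γ² ∑_{k=0}^{T} ‖d(k)‖². -/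
open Matrix

/-- Theorem 4 (piecewise quadratic storage function): dissipation-based
finite-horizon `l₂`-gain bound for a switched extended system with a piecewise
quadratic storage function `V_i(x) = xᵀP_ix`, each `P_i` symmetric positive
definite.  The controller channel `zc` satisfies a hard IQC with
model-dependent symmetric multipliers `Mφ_i`; the uncertainty channels `zu_j`
satisfy hard IQCs with symmetric multipliers `Mu_j`.  If the LMI-quadratic-form
inequality (nonstrict) holds at every `(ξ, ω, δ)` for every pair of models
`(i, j')`, then `∑_{k=0}^{T} ‖e(k)‖² ≤ γ² ∑_{k=0}^{T} ‖d(k)‖²` for every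
horizon `T`. -/
theorem switched_dissipation_pwq_storage
    {M N nx nw nd ne mc : ℕ} (mu : Fin N → ℕ)
    (A : Fin M → Matrix (Fin nx) (Fin nx) ℝ)
    (B1 : Fin M → Matrix (Fin nx) (Fin nw) ℝ)
    (B2 : Fin M → Matrix (Fin nx) (Fin nd) ℝ)
    (Cc : Fin M → Matrix (Fin mc) (Fin nx) ℝ)
    (Dc1 : Fin M → Matrix (Fin mc) (Fin nw) ℝ)
    (Dc2 : Fin M → Matrix (Fin mc) (Fin nd) ℝ)
    (Cu : Fin M → (j : Fin N) → Matrix (Fin (mu j)) (Fin nx) ℝ)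
    (Du1 : Fin M → (j : Fin N) → Matrix (Fin (mu j)) (Fin nw) ℝ)
    (Du2 : Fin M → (j : Fin N) → Matrix (Fin (mu j)) (Fin nd) ℝ)
    (C2 : Fin M → Matrix (Fin ne) (Fin nx) ℝ)
    (D21 : Fin M → Matrix (Fin ne) (Fin nw) ℝ)
    (D22 : Fin M → Matrix (Fin ne) (Fin nd) ℝ)
    (σ : ℕ → Fin M)
    (x : ℕ → Fin nx → ℝ) (w : ℕ → Fin nw → ℝ) (d : ℕ → Fin nd → ℝ)
    (e : ℕ → Fin ne → ℝ) (zc : ℕ → Fin mc → ℝ)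
    (zu : (j : Fin N) → ℕ → Fin (mu j) → ℝ)
    (hx0 : x 0 = 0)
    (hdyn : ∀ k, x (k + 1) = A (σ k) *ᵥ x k + B1 (σ k) *ᵥ w k + B2 (σ k) *ᵥ d k)
    (hzc : ∀ k, zc k = Cc (σ k) *ᵥ x k + Dc1 (σ k) *ᵥ w k + Dc2 (σ k) *ᵥ d k)
    (hzu : ∀ j k, zu j k = Cu (σ k) j *ᵥ x k + Du1 (σ k) j *ᵥ w k + Du2 (σ k) j *ᵥ d k)
    (he : ∀ k, e k = C2 (σ k) *ᵥ x k + D21 (σ k) *ᵥ w k + D22 (σ k) *ᵥ d k)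
    (Mphi : Fin M → Matrix (Fin mc) (Fin mc) ℝ) (hMphi : ∀ i, (Mphi i).IsSymm)
    (Mu : (j : Fin N) → Matrix (Fin (mu j)) (Fin (mu j)) ℝ) (hMu : ∀ j, (Mu j).IsSymm)
    (hIQCc : ∀ T : ℕ, 0 ≤ ∑ k ∈ Finset.range (T + 1), zc k ⬝ᵥ (Mphi (σ k) *ᵥ zc k))
    (hIQCu : ∀ j, ∀ T : ℕ, 0 ≤ ∑ k ∈ Finset.range (T + 1), zu j k ⬝ᵥ (Mu j *ᵥ zu j k))
    (P : Fin M → Matrix (Fin nx) (Fin nx) ℝ) (hP : ∀ i, (P i).PosDef)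
    (γ : ℝ) (hγ : 0 ≤ γ)
    (lu : Fin N → ℝ) (hlu : ∀ j, 0 ≤ lu j)
    (hLMI : ∀ (i i' : Fin M) (ξ : Fin nx → ℝ) (ω : Fin nw → ℝ) (δ : Fin nd → ℝ),
      (A i *ᵥ ξ + B1 i *ᵥ ω + B2 i *ᵥ δ) ⬝ᵥ
          (P i' *ᵥ (A i *ᵥ ξ + B1 i *ᵥ ω + B2 i *ᵥ δ))
        - ξ ⬝ᵥ (P i *ᵥ ξ)
        + (C2 i *ᵥ ξ + D21 i *ᵥ ω + D22 i *ᵥ δ) ⬝ᵥ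
            (C2 i *ᵥ ξ + D21 i *ᵥ ω + D22 i *ᵥ δ)
        + (Cc i *ᵥ ξ + Dc1 i *ᵥ ω + Dc2 i *ᵥ δ) ⬝ᵥ
            (Mphi i *ᵥ (Cc i *ᵥ ξ + Dc1 i *ᵥ ω + Dc2 i *ᵥ δ))
        + ∑ j, lu j * ((Cu i j *ᵥ ξ + Du1 i j *ᵥ ω + Du2 i j *ᵥ δ) ⬝ᵥ
            (Mu j *ᵥ (Cu i j *ᵥ ξ + Du1 i j *ᵥ ω + Du2 i j *ᵥ δ)))
        - γ ^ 2 * (δ ⬝ᵥ δ) ≤ 0) :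
    ∀ T : ℕ, ∑ k ∈ Finset.range (T + 1), e k ⬝ᵥ e k ≤
      γ ^ 2 * ∑ k ∈ Finset.range (T + 1), d k ⬝ᵥ d k := by
  intro T
  have hstep : ∀ k,
      (x (k + 1) ⬝ᵥ (P (σ (k + 1)) *ᵥ x (k + 1)) - x k ⬝ᵥ (P (σ k) *ᵥ x k))
        + e k ⬝ᵥ e k + zc k ⬝ᵥ (Mphi (σ k) *ᵥ zc k)
        + ∑ j, lu j * (zu j k ⬝ᵥ (Mu j *ᵥ zu j k)) - γ ^ 2 * (d k ⬝ᵥ d k) ≤ 0 := by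
    intro k
    have h := hLMI (σ k) (σ (k + 1)) (x k) (w k) (d k)
    simp only [← hdyn, ← hzc, ← hzu, ← he] at h
    exact h
  have hsum := Finset.sum_nonpos fun k (_ : k ∈ Finset.range (T + 1)) => hstep k
  rw [Finset.sum_sub_distrib, Finset.sum_add_distrib, Finset.sum_add_distrib,
    Finset.sum_add_distrib, Finset.sum_range_sub (fun k => x k ⬝ᵥ (P (σ k) *ᵥ x k)),
    ← Finset.mul_sum, hx0, zero_dotProduct, Finset.sum_comm] at hsum
  have hV : 0 ≤ x (T + 1) ⬝ᵥ (P (σ (T + 1)) *ᵥ x (T + 1)) := by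
    simpa using (hP (σ (T + 1))).posSemidef.dotProduct_mulVec_nonneg (x (T + 1))
  have hu : 0 ≤ ∑ j, ∑ k ∈ Finset.range (T + 1), lu j * (zu j k ⬝ᵥ (Mu j *ᵥ zu j k)) :=
    Finset.sum_nonneg fun j _ => by
      rw [← Finset.mul_sum]
      exact mul_nonneg (hlu j) (hIQCu j T)
  linarith [hIQCc T]
end
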